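/- Consider g(z, w) = (3/2)‖x‖⁴ + (wᵀz)² + (1/2)‖z‖²‖w‖² − 2(xᵀz)(xᵀw) − ‖x‖²(wᵀz) + (ρ/2)‖z − w‖² with x ≠ 0 and ρ ≥ (27/8)‖x‖². If (z⁽⁰⁾, w⁽⁰⁾) satisfies ‖z⁽⁰⁾ − x‖ ≤ (1/8)‖x‖ and ‖w⁽⁰⁾ − x‖ ≤ (1/8)‖x‖, then the block coordinate descent iterates z⁽ᵏ⁺¹⁾ = argmin_z g(z, w⁽ᵏ⁾), w⁽ᵏ⁺¹⁾ = argmin_w g(z⁽ᵏ⁺¹⁾, w) satisfy ‖(z⁽ᵏ⁾, w⁽ᵏ⁾) − (x, x)‖ ≤ (1 − ‖x‖²/(12‖x‖² + 3ρ))^{k/2} √((6/‖x‖²)(g(z⁽⁰⁾, w⁽⁰⁾) − g(x, x))). -/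

import Mathlib

open scoped RealInnerProductSpace

/-- The objective in terms of the Gram data of `a = z - x`, `b = w - x`. -/
noncomputable def bcdF (X ρ A B c s r : ℝ) : ℝ :=
  (s + r) ^ 2 + X * (A + B + 2 * c) / 2 + ρ / 2 * (A + B - 2 * c)
    + 2 * (s + r) * c + (s * B + r * A) + c ^ 2 + A * B / 2

/-- Scalar data constraints. -/
structure BcdOk (X A B c s r : ℝ) : Prop where
  hX : 0 < X
  hA0 : 0 ≤ A
  hB0 : 0 ≤ B
  hA : A ≤ X / 64
  hB : B ≤ X / 64
  hs : s ^ 2 ≤ X * A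
  hr : r ^ 2 ≤ X * B
  hc : c ^ 2 ≤ A * B
  hm : 0 ≤ A + B + 2 * c
  hd : 0 ≤ A + B - 2 * c
  hq : (s + r) ^ 2 ≤ X * (A + B + 2 * c)
  hp : (s - r) ^ 2 ≤ X * (A + B - 2 * c)
  hmd : (A - B) ^ 2 ≤ (A + B + 2 * c) * (A + B - 2 * c)

theorem BcdOk.symm {X A B c s r : ℝ} (h : BcdOk X A B c s r) : BcdOk X B A c r s where
  hX := h.hX
  hA0 := h.hB0
  hB0 := h.hA0
  hA := h.hB
  hB := h.hA
  hs := h.hr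
  hr := h.hs
  hc := by linarith [h.hc]
  hm := by linarith [h.hm]
  hd := by linarith [h.hd]
  hq := by linarith [h.hq]
  hp := by linarith [h.hp]
  hmd := by linarith [h.hmd]

theorem BcdOk.aux {X A B c s r : ℝ} (h : BcdOk X A B c s r) :
    |s + r| ≤ X / 4 ∧ |(s - r) * (A - B)| ≤ X * (A + B) / 4 ∧
      (A + B + 2 * c) ^ 2 ≤ X / 16 * (A + B + 2 * c) := by
  obtain ⟨hX, hA0, hB0, hA, hB, hs, hr, hc, hm, hd, hq, hp, hmd⟩ := h
  have hm2 : A + B + 2 * c ≤ X / 16 := by linarith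
  have hd2 : A + B - 2 * c ≤ X / 16 := by linarith
  refine ⟨?_, ?_, ?_⟩
  · apply abs_le_of_sq_le_sq _ (by positivity)
    nlinarith
  · apply abs_le_of_sq_le_sq _ (by positivity)
    have h1 : (s - r) ^ 2 ≤ X ^ 2 / 16 := by nlinarith
    have h2 : (A - B) ^ 2 ≤ (A + B) ^ 2 := by nlinarith
    calc ((s - r) * (A - B)) ^ 2 = (s - r) ^ 2 * (A - B) ^ 2 := by ring
      _ ≤ X ^ 2 / 16 * (A + B) ^ 2 := by gcongr
      _ = (X * (A + B) / 4) ^ 2 := by ring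
  · nlinarith

theorem bcd_sc {X ρ A B c s r : ℝ} (h : BcdOk X A B c s r) (hρ : 27 / 8 * X ≤ ρ) :
    X * (A + B) / 6 ≤ (s + r) ^ 2 + X * (A + B + 2 * c) / 2 + ρ / 2 * (A + B - 2 * c)
      + 2 * (2 * (s + r) * c + (s * B + r * A)) + 3 * (c ^ 2 + A * B / 2) := by
  obtain ⟨h1, h2, h3⟩ := h.aux
  obtain ⟨hX, hA0, hB0, hA, hB, hs, hr, hc, hm, hd, hq, hp, hmd⟩ := h
  have hT := (abs_le.1 h2).2
  have hqd := mul_le_mul_of_nonneg_right (abs_le.1 h1).2 hd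
  have hρd := mul_le_mul_of_nonneg_right hρ hd
  have hAB := mul_nonneg hA0 hB0
  have hXm := mul_nonneg hX.le hm
  have hXd := mul_nonneg hX.le hd
  nlinarith [sq_nonneg (s + r + 3 / 4 * (A + B + 2 * c)), sq_nonneg c]

theorem bcd_lb {X ρ A B c s r : ℝ} (h : BcdOk X A B c s r) (hρ : 27 / 8 * X ≤ ρ) :
    X * (A + B) / 6 ≤ bcdF X ρ A B c s r := by
  unfold bcdF
  obtain ⟨h1, h2, h3⟩ := h.aux
  obtain ⟨hX, hA0, hB0, hA, hB, hs, hr, hc, hm, hd, hq, hp, hmd⟩ := h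
  have hT := (abs_le.1 h2).2
  have hqd := mul_le_mul_of_nonneg_right (abs_le.1 h1).2 hd
  have hρd := mul_le_mul_of_nonneg_right hρ hd
  have hAB := mul_nonneg hA0 hB0
  have hXm := mul_nonneg hX.le hm
  have hXd := mul_nonneg hX.le hd
  nlinarith [sq_nonneg (s + r + 3 / 8 * (A + B + 2 * c)), sq_nonneg c]

/-- Linear and quadratic parts of the objective in the first block. -/
noncomputable def bcdL (X ρ B c s r : ℝ) : ℝ := 2 * s * r + X * c - ρ * c + 2 * r * c + s * B

noncomputable def bcdQ (X ρ A B c s r : ℝ) : ℝ := (X + 2 * r + B + ρ) * A / 2 + (s + c) ^ 2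

theorem bcdF_scale (X ρ A B c s r t : ℝ) :
    bcdF X ρ (t ^ 2 * A) B (t * c) (t * s) r =
      bcdF X ρ A B c s r + (t - 1) * bcdL X ρ B c s r + (t ^ 2 - 1) * bcdQ X ρ A B c s r := by
  unfold bcdF bcdL bcdQ; ring

theorem bcdF_symm (X ρ A B c s r : ℝ) : bcdF X ρ A B c s r = bcdF X ρ B A c r s := by
  unfold bcdF; ring

theorem bcd_foc {X ρ A B c s r : ℝ}
    (h : ∀ t : ℝ, bcdF X ρ A B c s r ≤ bcdF X ρ (t ^ 2 * A) B (t * c) (t * s) r) :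
    bcdL X ρ B c s r + 2 * bcdQ X ρ A B c s r ≤ 0 := by
  by_contra! hcon
  set L := bcdL X ρ B c s r
  set Q := bcdQ X ρ A B c s r
  have h1 : ∀ e : ℝ, 0 ≤ -e * (L + 2 * Q) + e ^ 2 * Q := by
    intro e
    have := h (1 - e)
    rw [bcdF_scale] at this
    nlinarith
  have hQ : 0 < |Q| + 1 := by positivity
  have h2 := h1 ((L + 2 * Q) / (|Q| + 1))
  have h3 : -((L + 2 * Q) / (|Q| + 1)) * (L + 2 * Q) + ((L + 2 * Q) / (|Q| + 1)) ^ 2 * Q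
      = (L + 2 * Q) ^ 2 / (|Q| + 1) ^ 2 * (Q - (|Q| + 1)) := by
    field_simp
    ring
  rw [h3] at h2
  have h4 : 0 < (L + 2 * Q) ^ 2 / (|Q| + 1) ^ 2 := by positivity
  nlinarith [le_abs_self Q]

/-- Contraction of the second half-step (block `b` moves, block `a` already optimal). -/
theorem bcd_contract {X ρ A B c s r : ℝ} (h : BcdOk X A B c s r) (hρ : 27 / 8 * X ≤ ρ)
    (hfoc : bcdL X ρ B c s r + 2 * bcdQ X ρ A B c s r ≤ 0)
    (hzb : (r + c) ^ 2 ≤ (X + 2 * s + A) * B) (t : ℝ)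
    (ht : t = X / (12 * X + 3 * ρ)) :
    bcdF X ρ A ((1 - t) ^ 2 * B) ((1 - t) * c) s ((1 - t) * r) ≤ (1 - t) * bcdF X ρ A B c s r := by
  rw [bcdF_symm, bcdF_scale, bcdF_symm X ρ B A c r s]
  have hsc := bcd_sc h hρ
  have hX := h.hX
  have hρ0 : 0 < ρ := by linarith
  have ht0 : 0 < t := by rw [ht]; positivity
  have htL : t * (4 * X + ρ) = X / 3 := by rw [ht]; field_simp; ring
  have hss : 2 * s ≤ X / 4 := by
    have : |s| ≤ X / 8 := by
      apply abs_le_of_sq_le_sq _ (by positivity)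
      nlinarith [h.hs, h.hA]
    linarith [(abs_le.1 this).2]
  have hQ : bcdQ X ρ B A c r s ≤ (4 * X + ρ) / 2 * B := by
    unfold bcdQ
    nlinarith [h.hB0, h.hA]
  have htot : bcdF X ρ A B c s r + X * (A + B) / 6 ≤
      bcdL X ρ A c r s + 2 * bcdQ X ρ B A c r s := by
    unfold bcdF
    unfold bcdL bcdQ at *
    nlinarith
  have h5 : t ^ 2 * bcdQ X ρ B A c r s ≤ t * (X * B / 6) := by
    calc t ^ 2 * bcdQ X ρ B A c r s ≤ t ^ 2 * ((4 * X + ρ) / 2 * B) := by gcongr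
      _ = t * (t * (4 * X + ρ)) * B / 2 := by ring
      _ = t * (X * B / 6) := by rw [htL]; ring
  have h6 := mul_le_mul_of_nonneg_left htot ht0.le
  have h7 : 0 ≤ t * (X * A) := by have := h.hA0; positivity
  nlinarith

/-- The minimiser stays in the ball. -/
theorem bcd_ball {X ρ A B c s r : ℝ} (hX : 0 < X) (hρ : 27 / 8 * X ≤ ρ)
    (hB0 : 0 ≤ B) (hB : B ≤ X / 64) (hr : r ^ 2 ≤ X * B)
    (hv : ∀ N p u : ℝ, 0 ≤ N ^ 2 * A - 2 * N * (p * c - u * s)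
        + (p ^ 2 * B - 2 * p * u * r + u ^ 2 * X))
    (hfoc : bcdL X ρ B c s r + 2 * bcdQ X ρ A B c s r ≤ 0) : A ≤ B := by
  have hrr : |r| ≤ X / 8 := by
    apply abs_le_of_sq_le_sq _ (by positivity)
    nlinarith
  obtain ⟨hr1, hr2⟩ := abs_le.1 hrr
  have hN : 0 < ρ + X + 2 * r + B := by linarith
  have h1 := hv (ρ + X + 2 * r + B) (ρ - X - 2 * r) (2 * r + B)
  have h2 : (ρ + X + 2 * r + B) * A ≤ (ρ - X - 2 * r) * c - (2 * r + B) * s := by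
    unfold bcdL bcdQ at hfoc
    nlinarith [sq_nonneg (s + c)]
  have h3 := mul_le_mul_of_nonneg_left h2 hN.le
  have h4 : (ρ - X - 2 * r) ^ 2 * B - 2 * (ρ - X - 2 * r) * (2 * r + B) * r + (2 * r + B) ^ 2 * X
      ≤ (ρ + X + 2 * r + B) ^ 2 * B := by
    obtain ⟨p, hp⟩ : ∃ p, p = ρ - X - 2 * r := ⟨_, rfl⟩
    have hp2 : 2 * X ≤ p := by linarith
    have e : ρ + X + 2 * r + B = p + (2 * X + 4 * r + B) := by rw [hp]; ring
    rw [e, ← hp]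
    have k1 : 0 ≤ (p - X) * r ^ 2 := mul_nonneg (by linarith) (sq_nonneg _)
    have k2 : 0 ≤ 2 * p * (2 * X + 4 * r + B) + 2 * p * r - 4 * r * X - B * X := by
      nlinarith
    have k3 := mul_nonneg hB0 k2
    have k4 : 0 ≤ B * (2 * X + 4 * r + B) ^ 2 := by positivity
    nlinarith
  have h5 : (ρ + X + 2 * r + B) ^ 2 * A ≤ (ρ + X + 2 * r + B) ^ 2 * B := by nlinarith
  exact le_of_mul_le_mul_left h5 (by positivity)

section vec
variable {E : Type*} [NormedAddCommGroup E] [InnerProductSpace ℝ E]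

theorem bcd_cs (u v : E) : ⟪u, v⟫ ^ 2 ≤ ‖u‖ ^ 2 * ‖v‖ ^ 2 := by
  rw [← mul_pow]
  exact sq_le_sq' (by linarith [(abs_le.1 (abs_real_inner_le_norm u v)).1]) (real_inner_le_norm u v)

theorem bcd_ok (x a b : E) (hx : x ≠ 0) (ha : ‖a‖ ^ 2 ≤ ‖x‖ ^ 2 / 64)
    (hb : ‖b‖ ^ 2 ≤ ‖x‖ ^ 2 / 64) :
    BcdOk (‖x‖ ^ 2) (‖a‖ ^ 2) (‖b‖ ^ 2) ⟪a, b⟫ ⟪x, a⟫ ⟪x, b⟫ := by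
  have hp : ‖a‖ ^ 2 + ‖b‖ ^ 2 + 2 * ⟪a, b⟫ = ‖a + b‖ ^ 2 := by
    rw [norm_add_sq_real]; ring
  have hm : ‖a‖ ^ 2 + ‖b‖ ^ 2 - 2 * ⟪a, b⟫ = ‖a - b‖ ^ 2 := by
    rw [norm_sub_sq_real]; ring
  refine ⟨by positivity, by positivity, by positivity, ha, hb, bcd_cs _ _, bcd_cs _ _, bcd_cs _ _,
    by rw [hp]; positivity, by rw [hm]; positivity, ?_, ?_, ?_⟩
  · rw [hp, ← inner_add_right]; exact bcd_cs _ _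
  · rw [hm, ← inner_sub_right]; exact bcd_cs _ _
  · rw [hp, hm]
    have := bcd_cs (a + b) (a - b)
    rwa [inner_add_left, inner_sub_right, inner_sub_right, real_inner_self_eq_norm_sq,
      real_inner_self_eq_norm_sq, real_inner_comm a b, sub_add_sub_cancel] at this

/-- Objective in vector form, centred at `x`. -/
noncomputable def bcdV (x : E) (ρ : ℝ) (a b : E) : ℝ :=
  bcdF (‖x‖ ^ 2) ρ (‖a‖ ^ 2) (‖b‖ ^ 2) ⟪a, b⟫ ⟪x, a⟫ ⟪x, b⟫

theorem bcdV_symm (x : E) (ρ : ℝ) (a b : E) : bcdV x ρ a b = bcdV x ρ b a := by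
  unfold bcdV; rw [bcdF_symm, real_inner_comm]

theorem bcdV_smul (x : E) (ρ t : ℝ) (a b : E) : bcdV x ρ (t • a) b =
    bcdF (‖x‖ ^ 2) ρ (t ^ 2 * ‖a‖ ^ 2) (‖b‖ ^ 2) (t * ⟪a, b⟫) (t * ⟪x, a⟫) ⟪x, b⟫ := by
  unfold bcdV
  rw [norm_smul, mul_pow, real_inner_smul_left, real_inner_smul_right, Real.norm_eq_abs, sq_abs]

theorem bcdV_eq (x : E) (ρ : ℝ) (z w : E) :
    (3 / 2) * ‖x‖ ^ 4 + ⟪w, z⟫ ^ 2 + (1 / 2) * ‖z‖ ^ 2 * ‖w‖ ^ 2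
        - 2 * ⟪x, z⟫ * ⟪x, w⟫ - ‖x‖ ^ 2 * ⟪w, z⟫ + (ρ / 2) * ‖z - w‖ ^ 2
      = bcdV x ρ (z - x) (w - x) := by
  obtain ⟨a, rfl⟩ : ∃ a, z = x + a := ⟨z - x, by abel⟩
  obtain ⟨b, rfl⟩ : ∃ b, w = x + b := ⟨w - x, by abel⟩
  unfold bcdV bcdF
  rw [add_sub_cancel_left, add_sub_cancel_left, add_sub_add_left_eq_sub, norm_sub_sq_real,
    norm_add_sq_real, norm_add_sq_real]
  simp only [inner_add_left, inner_add_right, real_inner_self_eq_norm_sq, real_inner_comm x b,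
    real_inner_comm a b]
  ring

theorem bcdV_foc (x : E) (ρ : ℝ) (a b : E) (hmin : ∀ a', bcdV x ρ a b ≤ bcdV x ρ a' b) :
    bcdL (‖x‖ ^ 2) ρ (‖b‖ ^ 2) ⟪a, b⟫ ⟪x, a⟫ ⟪x, b⟫
      + 2 * bcdQ (‖x‖ ^ 2) ρ (‖a‖ ^ 2) (‖b‖ ^ 2) ⟪a, b⟫ ⟪x, a⟫ ⟪x, b⟫ ≤ 0 := by
  apply bcd_foc
  intro t
  have := hmin (t • a)
  rwa [bcdV_smul] at this

theorem bcdV_ball (x : E) (hx : x ≠ 0) (ρ : ℝ) (hρ : 27 / 8 * ‖x‖ ^ 2 ≤ ρ) (a b : E)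
    (hb : ‖b‖ ^ 2 ≤ ‖x‖ ^ 2 / 64) (hmin : ∀ a', bcdV x ρ a b ≤ bcdV x ρ a' b) :
    ‖a‖ ^ 2 ≤ ‖x‖ ^ 2 / 64 := by
  refine le_trans (bcd_ball (by positivity) hρ (by positivity) hb (bcd_cs x b) ?_
    (bcdV_foc x ρ a b hmin)) hb
  intro N p u
  have h : 0 ≤ ‖N • a - (p • b - u • x)‖ ^ 2 := by positivity
  rw [norm_sub_sq_real, norm_sub_sq_real] at h
  simp only [inner_sub_right, real_inner_smul_left, real_inner_smul_right, norm_smul, mul_pow,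
    Real.norm_eq_abs, sq_abs] at h
  rw [real_inner_comm x a, real_inner_comm x b] at h
  linarith

theorem bcdV_step (x : E) (hx : x ≠ 0) (ρ : ℝ) (hρ : 27 / 8 * ‖x‖ ^ 2 ≤ ρ) (a b b' : E)
    (hb : ‖b‖ ^ 2 ≤ ‖x‖ ^ 2 / 64) (hmin : ∀ a', bcdV x ρ a b ≤ bcdV x ρ a' b)
    (hmin' : ∀ c, bcdV x ρ a b' ≤ bcdV x ρ a c) :
    bcdV x ρ a b' ≤ (1 - ‖x‖ ^ 2 / (12 * ‖x‖ ^ 2 + 3 * ρ)) * bcdV x ρ a b := by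
  have ha := bcdV_ball x hx ρ hρ a b hb hmin
  have hzb : (⟪x, b⟫ + ⟪a, b⟫) ^ 2 ≤ (‖x‖ ^ 2 + 2 * ⟪x, a⟫ + ‖a‖ ^ 2) * ‖b‖ ^ 2 := by
    rw [← inner_add_left, ← norm_add_sq_real]; exact bcd_cs _ _
  have h := bcd_contract (bcd_ok x a b hx ha hb) hρ (bcdV_foc x ρ a b hmin) hzb _ rfl
  refine le_trans (hmin' ((1 - ‖x‖ ^ 2 / (12 * ‖x‖ ^ 2 + 3 * ρ)) • b)) ?_
  rw [bcdV_symm, bcdV_smul, bcdF_symm, real_inner_comm]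
  exact h

end vec

theorem stmt_18 {n : ℕ} (x : EuclideanSpace ℝ (Fin n)) (hx : x ≠ 0)
    (ρ : ℝ) (hρ : (27 / 8) * ‖x‖ ^ 2 ≤ ρ)
    (g : EuclideanSpace ℝ (Fin n) → EuclideanSpace ℝ (Fin n) → ℝ)
    (hg : g = fun z w => (3 / 2) * ‖x‖ ^ 4 + ⟪w, z⟫ ^ 2 + (1 / 2) * ‖z‖ ^ 2 * ‖w‖ ^ 2
        - 2 * ⟪x, z⟫ * ⟪x, w⟫ - ‖x‖ ^ 2 * ⟪w, z⟫ + (ρ / 2) * ‖z - w‖ ^ 2)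
    (z w : ℕ → EuclideanSpace ℝ (Fin n))
    (hz0 : ‖z 0 - x‖ ≤ (1 / 8) * ‖x‖) (hw0 : ‖w 0 - x‖ ≤ (1 / 8) * ‖x‖)
    (hzstep : ∀ k, ∀ z' : EuclideanSpace ℝ (Fin n), g (z (k + 1)) (w k) ≤ g z' (w k))
    (hwstep : ∀ k, ∀ w' : EuclideanSpace ℝ (Fin n), g (z (k + 1)) (w (k + 1)) ≤ g (z (k + 1)) w') :
    ∀ k : ℕ,
      Real.sqrt (‖z k - x‖ ^ 2 + ‖w k - x‖ ^ 2) ≤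
        (1 - ‖x‖ ^ 2 / (12 * ‖x‖ ^ 2 + 3 * ρ)) ^ ((k : ℝ) / 2) *
          Real.sqrt ((6 / ‖x‖ ^ 2) * (g (z 0) (w 0) - g x x)) := by
  have hgV : ∀ z w, g z w = bcdV x ρ (z - x) (w - x) := by
    intro z w; rw [hg]; exact bcdV_eq x ρ z w
  have hgx : g x x = 0 := by rw [hgV]; simp [bcdV, bcdF]
  have hX : 0 < ‖x‖ ^ 2 := by positivity
  have hρ0 : 0 < ρ := by linarith
  have hzmin : ∀ k a', bcdV x ρ (z (k + 1) - x) (w k - x) ≤ bcdV x ρ a' (w k - x) := by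
    intro k a'
    have := hzstep k (a' + x)
    rwa [hgV, hgV, add_sub_cancel_right] at this
  have hwmin : ∀ k b', bcdV x ρ (z (k + 1) - x) (w (k + 1) - x) ≤ bcdV x ρ (z (k + 1) - x) b' := by
    intro k b'
    have := hwstep k (b' + x)
    rwa [hgV, hgV, add_sub_cancel_right] at this
  set θ := 1 - ‖x‖ ^ 2 / (12 * ‖x‖ ^ 2 + 3 * ρ) with hθ
  have hθ0 : 0 ≤ θ := by
    rw [hθ, sub_nonneg, div_le_one (by positivity)]; linarith
  have main : ∀ k, ‖z k - x‖ ^ 2 ≤ ‖x‖ ^ 2 / 64 ∧ ‖w k - x‖ ^ 2 ≤ ‖x‖ ^ 2 / 64 ∧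
      bcdV x ρ (z k - x) (w k - x) ≤ θ ^ k * g (z 0) (w 0) := by
    intro k
    induction k with
    | zero =>
      refine ⟨?_, ?_, ?_⟩
      · nlinarith [norm_nonneg (z 0 - x), norm_nonneg x]
      · nlinarith [norm_nonneg (w 0 - x), norm_nonneg x]
      · rw [hgV]; simp
    | succ k ih =>
      obtain ⟨_, i2, i3⟩ := ih
      have j1 := bcdV_ball x hx ρ hρ _ _ i2 (hzmin k)
      refine ⟨j1, ?_, ?_⟩
      · apply bcdV_ball x hx ρ hρ (w (k + 1) - x) (z (k + 1) - x) j1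
        intro b'
        rw [bcdV_symm, bcdV_symm x ρ b']
        exact hwmin k b'
      · calc _ ≤ θ * bcdV x ρ (z (k + 1) - x) (w k - x) :=
              bcdV_step x hx ρ hρ _ _ _ i2 (hzmin k) (hwmin k)
          _ ≤ θ * bcdV x ρ (z k - x) (w k - x) := by gcongr; exact hzmin k _
          _ ≤ θ * (θ ^ k * g (z 0) (w 0)) := by gcongr
          _ = θ ^ (k + 1) * g (z 0) (w 0) := by ring
  intro k
  obtain ⟨m1, m2, m3⟩ := main k
  have hlb := bcd_lb (bcd_ok x _ _ hx m1 m2) hρ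
  change _ ≤ bcdV x ρ (z k - x) (w k - x) at hlb
  have hpow : θ ^ ((k : ℝ) / 2) = Real.sqrt (θ ^ k) := by
    rw [Real.sqrt_eq_rpow, ← Real.rpow_natCast, ← Real.rpow_mul hθ0]
    congr 1; ring
  rw [hpow, ← Real.sqrt_mul (by positivity), hgx, sub_zero]
  apply Real.sqrt_le_sqrt
  have : θ ^ k * (6 / ‖x‖ ^ 2 * g (z 0) (w 0)) = (6 * (θ ^ k * g (z 0) (w 0))) / ‖x‖ ^ 2 := by ring
  rw [this, le_div_iff₀ hX]
  linarith
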